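/- Let E be a row-finite directed graph with no sources satisfying Condition (K), R a commutative ring with identity, and let π₁, π₂ : H_E → L(R) both satisfy π(⋁_{H∈A} H) = ⋂_{H∈A} π(H) for every subset A ⊆ H_E. Then Γ(π₁) ⊆ Γ(π₂) if and only if π₁(H) ⊆ π₂(H) for every H ∈ H_E, where Γ(π) = span_R{ r·s_μ·s_ν* : there exists H ∈ H_E with r ∈ π(H) and s_μ s_ν* ∈ I_H }. -/

import Mathlib

noncomputable section

/-- A directed graph with vertex set `V`, edge set `E`, range map `r` and source map `s`. -/
structure DGraph (V E : Type) where
  r : E → V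
  s : E → V

namespace DGraph

variable {V E : Type} (G : DGraph V E)

/-- `E` is row-finite: `vE¹ = {e : r(e) = v}` is finite for every vertex `v`. -/
def RowFinite : Prop := ∀ v : V, {e : E | G.r e = v}.Finite

/-- `E` has no sources: `vE¹` is nonempty for every vertex `v`. -/
def NoSources : Prop := ∀ v : V, {e : E | G.r e = v}.Nonempty

/-- A finite path in `G`: a list of edges `e₁ ⋯ eₙ` with `s(eᵢ) = r(eᵢ₊₁)`, together with
a base vertex which equals the source `s(eₙ)` of the last edge (for the empty path, the
path is just the vertex `base`). -/
structure Path (G : DGraph V E) where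
  base : V
  edges : List E
  chain : edges.Chain' (fun e f => G.s e = G.r f)
  last_src : ∀ e ∈ edges.getLast?, G.s e = base

/-- The source vertex of a finite path. -/
def Path.src {G : DGraph V E} (p : Path G) : V := p.base

/-- The range vertex of a finite path. -/
def Path.rng {G : DGraph V E} (p : Path G) : V :=
  (p.edges.head?.map G.r).getD p.base

/-- A return path based at `v`: a finite path of positive length with range and source `v`
which visits `v` only as its range and source. -/
def IsReturnPath (v : V) (p : Path G) : Prop :=
  p.edges ≠ [] ∧ p.rng = v ∧ p.src = v ∧ ∀ e ∈ p.edges.dropLast, G.s e ≠ v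

/-- Condition (K): every vertex is the base of no return path or of at least two distinct
return paths. -/
def CondK : Prop :=
  ∀ v : V, (∀ p : Path G, ¬ G.IsReturnPath v p) ∨
    ∃ p q : Path G, p ≠ q ∧ G.IsReturnPath v p ∧ G.IsReturnPath v q

/-- A subset `H ⊆ E⁰` is hereditary and saturated. -/
def SatHereditary (H : Set V) : Prop :=
  (∀ e : E, G.r e ∈ H → G.s e ∈ H) ∧
  (∀ v : V, (∀ e : E, G.r e = v → G.s e ∈ H) → v ∈ H)

/-- The smallest saturated hereditary subset of `E⁰` containing every member of `A`. -/
def satHerClosure (A : Set (Set V)) : Set V :=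
  ⋂₀ {H : Set V | G.SatHereditary H ∧ ∀ K ∈ A, K ⊆ H}

lemma satHerClosure_satHereditary (A : Set (Set V)) :
    G.SatHereditary (G.satHerClosure A) := by
  constructor
  · intro e he
    exact Set.mem_sInter.mpr fun H hH => hH.1.1 e (Set.mem_sInter.mp he H hH)
  · intro v hv
    exact Set.mem_sInter.mpr fun H hH =>
      hH.1.2 v (fun e hre => Set.mem_sInter.mp (hv e hre) H hH)

end DGraph

/-- The generators of the Leavitt path algebra: vertex projections `p_v`, edge generators
`s_e` and ghost edge generators `s_e*`. -/
inductive LGen (V E : Type)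
  | vert : V → LGen V E
  | edge : E → LGen V E
  | star : E → LGen V E

variable (R : Type) [CommRing R] {V E : Type}

/-- The generator `p_v` in the free algebra. -/
def pF (v : V) : FreeAlgebra R (LGen V E) := FreeAlgebra.ι R (LGen.vert v)

/-- The generator `s_e` in the free algebra. -/
def sF (e : E) : FreeAlgebra R (LGen V E) := FreeAlgebra.ι R (LGen.edge e)

/-- The generator `s_e*` in the free algebra. -/
def tF (e : E) : FreeAlgebra R (LGen V E) := FreeAlgebra.ι R (LGen.star e)

/-- The defining relations of the Leavitt path algebra of a row-finite graph. -/
inductive LRel (G : DGraph V E) (hfin : G.RowFinite) :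
    FreeAlgebra R (LGen V E) → FreeAlgebra R (LGen V E) → Prop
  | vert_same (v : V) : LRel G hfin (pF R v * pF R v) (pF R v)
  | vert_ne (v w : V) (h : v ≠ w) : LRel G hfin (pF R v * pF R w) 0
  | range_edge (e : E) : LRel G hfin (pF R (G.r e) * sF R e) (sF R e)
  | edge_source (e : E) : LRel G hfin (sF R e * pF R (G.s e)) (sF R e)
  | source_star (e : E) : LRel G hfin (pF R (G.s e) * tF R e) (tF R e)
  | star_range (e : E) : LRel G hfin (tF R e * pF R (G.r e)) (tF R e)
  | star_edge_same (e : E) : LRel G hfin (tF R e * sF R e) (pF R (G.s e))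
  | star_edge_ne (e f : E) (h : e ≠ f) : LRel G hfin (tF R e * sF R f) 0
  | cuntz_krieger (v : V) :
      LRel G hfin (pF R v) (∑ e ∈ (hfin v).toFinset, sF R e * tF R e)

/-- The Leavitt path algebra `L_R(E)` of a row-finite graph. -/
abbrev LeavittPathAlgebra (G : DGraph V E) (hfin : G.RowFinite) :=
  RingQuot (LRel R G hfin)

variable (G : DGraph V E) (hfin : G.RowFinite)

/-- `p_v` in the Leavitt path algebra. -/
def pL (v : V) : LeavittPathAlgebra R G hfin :=
  RingQuot.mkAlgHom R (LRel R G hfin) (pF R v)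

/-- `s_e` in the Leavitt path algebra. -/
def sL (e : E) : LeavittPathAlgebra R G hfin :=
  RingQuot.mkAlgHom R (LRel R G hfin) (sF R e)

/-- `s_e*` in the Leavitt path algebra. -/
def tL (e : E) : LeavittPathAlgebra R G hfin :=
  RingQuot.mkAlgHom R (LRel R G hfin) (tF R e)

/-- `s_μ` for a finite path `μ` (with `s_v = p_v` for a vertex). -/
def sPath (p : G.Path) : LeavittPathAlgebra R G hfin :=
  RingQuot.mkAlgHom R (LRel R G hfin)
    (match p.edges with
      | [] => pF R p.base
      | es => (es.map (sF R)).prod)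

/-- `s_μ*` for a finite path `μ` (with `s_v* = p_v` for a vertex). -/
def sStarPath (p : G.Path) : LeavittPathAlgebra R G hfin :=
  RingQuot.mkAlgHom R (LRel R G hfin)
    (match p.edges with
      | [] => pF R p.base
      | es => (es.reverse.map (tF R)).prod)


/-- The set `H_E` of saturated hereditary subsets of `E⁰`. -/
def HESet {V E : Type} (G : DGraph V E) := {H : Set V // G.SatHereditary H}

/-- `⋁_{H ∈ A} H`: the smallest saturated hereditary subset containing every `H ∈ A`. -/
def veeHE {V E : Type} (G : DGraph V E) (A : Set (HESet G)) : HESet G :=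
  ⟨G.satHerClosure (Subtype.val '' A), G.satHerClosure_satHereditary _⟩

/-- The two-sided ideal of a (possibly nonunital, noncommutative) ring generated by a set:
the smallest two-sided ideal containing it. -/
def twoSidedSpan {A : Type*} [NonUnitalNonAssocRing A] (S : Set A) : TwoSidedIdeal A :=
  sInf {J : TwoSidedIdeal A | S ⊆ (J : Set A)}

/-- A function `π : H_E → L(R)` satisfying `π(⋁_{H∈A} H) = ⋂_{H∈A} π(H)` for every
`A ⊆ H_E` (the empty intersection being all of `R`). -/
def ConsistentHE {V E : Type} (R : Type) [CommRing R] (G : DGraph V E)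
    (π : HESet G → Ideal R) : Prop :=
  ∀ A : Set (HESet G), π (veeHE G A) = ⨅ H ∈ A, π H

/-- `I_H`: the two-sided ideal of `L_R(E)` generated by `{p_v : v ∈ H}`. -/
def IH (H : HESet G) : TwoSidedIdeal (LeavittPathAlgebra R G hfin) :=
  twoSidedSpan {x : LeavittPathAlgebra R G hfin | ∃ v ∈ H.1, x = pL R G hfin v}

/-- The generating set of `Γ(π)`:
`{ r·s_μ·s_ν* : ∃ H ∈ H_E, r ∈ π(H) and s_μ s_ν* ∈ I_H }`. -/
def GammaLSet (π : HESet G → Ideal R) : Set (LeavittPathAlgebra R G hfin) :=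
  {x : LeavittPathAlgebra R G hfin |
    ∃ (r : R) (mu nu : G.Path) (H : HESet G), r ∈ π H ∧
      sPath R G hfin mu * sStarPath R G hfin nu ∈ IH R G hfin H ∧
      x = r • (sPath R G hfin mu * sStarPath R G hfin nu)}

namespace DGraph

/-- An infinite path `e₀ e₁ e₂ ⋯` in `G`, with `s(eₙ) = r(eₙ₊₁)`. -/
@[ext]
structure InfPath {V E : Type} (G : DGraph V E) where
  edge : ℕ → E
  source_edge : ∀ n, G.s (edge n) = G.r (edge (n + 1))

namespace InfPath

variable {G}

/-- The `n`-th vertex visited by an infinite path. -/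
def vertex (x : G.InfPath) (n : ℕ) : V := G.r (x.edge n)

/-- The infinite path obtained by removing the first edge. -/
def tail (x : G.InfPath) : G.InfPath := ⟨fun n => x.edge (n + 1), fun n => x.source_edge (n + 1)⟩

/-- The infinite path obtained by prepending an edge. -/
def cons (e : E) (x : G.InfPath) (h : G.s e = x.vertex 0) : G.InfPath :=
  ⟨fun n => n.casesOn e x.edge, fun n => by
    cases n with
    | zero => exact h
    | succ n => exact x.source_edge n⟩

@[simp] lemma tail_cons (e : E) (x : G.InfPath) (h : G.s e = x.vertex 0) :
    (cons e x h).tail = x := rfl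

@[simp] lemma cons_apply_zero (e : E) (x : G.InfPath) (h : G.s e = x.vertex 0) :
    (cons e x h).edge 0 = e := rfl

lemma vertex_tail (x : G.InfPath) (n : ℕ) : x.tail.vertex n = x.vertex (n + 1) := rfl

lemma vertex_zero (x : G.InfPath) : x.vertex 0 = G.r (x.edge 0) := rfl

lemma source_apply_zero (x : G.InfPath) : G.s (x.edge 0) = x.tail.vertex 0 := x.source_edge 0

lemma cons_tail (x : G.InfPath) (h : G.s (x.edge 0) = x.tail.vertex 0) :
    cons (x.edge 0) x.tail h = x := by
  ext n
  cases n <;> rfl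

end InfPath

/-- From every vertex outside a saturated set there is an infinite path avoiding that set. -/
lemma exists_infPath_avoiding {T : Set V}
    (hT : ∀ v, (∀ e : E, G.r e = v → G.s e ∈ T) → v ∈ T) {v : V} (hv : v ∉ T) :
    ∃ x : G.InfPath, x.vertex 0 = v ∧ ∀ n, x.vertex n ∉ T := by
  have step : ∀ w : {w : V // w ∉ T}, ∃ e : E, G.r e = w.1 ∧ G.s e ∉ T := by
    intro w
    by_contra! h
    exact w.2 (hT w.1 h)
  choose f hr hs using step
  let w : ℕ → {w : V // w ∉ T} := fun n => n.rec ⟨v, hv⟩ fun _ u => ⟨G.s (f u), hs u⟩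
  refine ⟨⟨fun n => f (w n), fun n => (hr (w (n + 1))).symm⟩, hr (w 0), fun n => ?_⟩
  have h : G.r (f (w n)) = (w n).1 := hr (w n)
  change G.r (f (w n)) ∉ T
  rw [h]
  exact (w n).2

end DGraph

open DGraph InfPath

open Classical in
/-- The action of the generators of the Leavitt path algebra on functions on infinite paths. -/
def genAction : LGen V E → Module.End R (G.InfPath → R)
  | .vert v =>
    { toFun := fun f x => if x.vertex 0 = v then f x else 0
      map_add' := fun f g => by funext x; simp only [Pi.add_apply]; split_ifs <;> simp
      map_smul' := fun c f => by funext x; simp }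
  | .edge e =>
    { toFun := fun f x => if x.edge 0 = e then f x.tail else 0
      map_add' := fun f g => by funext x; simp only [Pi.add_apply]; split_ifs <;> simp
      map_smul' := fun c f => by funext x; simp }
  | .star e =>
    { toFun := fun f x => if h : G.s e = x.vertex 0 then f (cons e x h) else 0
      map_add' := fun f g => by funext x; simp only [Pi.add_apply]; split_ifs <;> simp
      map_smul' := fun c f => by funext x; simp }

open Classical in
lemma genAction_vert (v : V) (f : G.InfPath → R) (x : G.InfPath) :
    genAction R G (.vert v) f x = if x.vertex 0 = v then f x else 0 := rfl

open Classical in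
lemma genAction_edge (e : E) (f : G.InfPath → R) (x : G.InfPath) :
    genAction R G (.edge e) f x = if x.edge 0 = e then f x.tail else 0 := rfl

open Classical in
lemma genAction_star (e : E) (f : G.InfPath → R) (x : G.InfPath) :
    genAction R G (.star e) f x = if h : G.s e = x.vertex 0 then f (cons e x h) else 0 := rfl

open Classical in
lemma genAction_rel {a b : FreeAlgebra R (LGen V E)} (h : LRel R G hfin a b) :
    FreeAlgebra.lift R (genAction R G) a = FreeAlgebra.lift R (genAction R G) b := by
  apply LinearMap.ext
  intro f
  funext x
  induction h with
  | vert_same v =>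
    simp only [pF, map_mul, FreeAlgebra.lift_ι_apply, Module.End.mul_apply, genAction_vert]
    split_ifs <;> rfl
  | vert_ne v w h =>
    simp only [pF, map_mul, map_zero, FreeAlgebra.lift_ι_apply, Module.End.mul_apply,
      genAction_vert, LinearMap.zero_apply, Pi.zero_apply]
    split_ifs with h₁ h₂
    · exact absurd (h₁.symm.trans h₂) h
    · rfl
    · rfl
  | range_edge e =>
    simp only [pF, sF, map_mul, FreeAlgebra.lift_ι_apply, Module.End.mul_apply, genAction_vert,
      genAction_edge, vertex_zero]
    grind
  | edge_source e =>
    simp only [pF, sF, map_mul, FreeAlgebra.lift_ι_apply, Module.End.mul_apply, genAction_vert,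
      genAction_edge]
    split_ifs with h₁ h₂
    · rfl
    · exact absurd (h₁ ▸ x.source_apply_zero.symm) h₂
    · rfl
  | source_star e =>
    simp only [pF, tF, map_mul, FreeAlgebra.lift_ι_apply, Module.End.mul_apply, genAction_vert,
      genAction_star]
    split_ifs with h₁ h₂ h₂
    · rfl
    · rfl
    · exact absurd h₂.symm h₁
    · rfl
  | star_range e =>
    simp only [pF, tF, map_mul, FreeAlgebra.lift_ι_apply, Module.End.mul_apply, genAction_vert,
      genAction_star, vertex_zero (cons e x _)]
    by_cases h : G.s e = x.vertex 0
    · rw [dif_pos h, dif_pos h, if_pos (by rw [cons_apply_zero])]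
    · rw [dif_neg h, dif_neg h]
  | star_edge_same e =>
    simp only [pF, sF, tF, map_mul, FreeAlgebra.lift_ι_apply, Module.End.mul_apply,
      genAction_vert, genAction_edge, genAction_star, cons_apply_zero, tail_cons, if_true]
    split_ifs with h₁ h₂ h₂
    · rfl
    · exact absurd h₁.symm h₂
    · exact absurd h₂.symm h₁
    · rfl
  | star_edge_ne e g h =>
    simp only [sF, tF, map_mul, map_zero, FreeAlgebra.lift_ι_apply, Module.End.mul_apply,
      genAction_edge, genAction_star, LinearMap.zero_apply, Pi.zero_apply]
    by_cases h₁ : G.s e = x.vertex 0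
    · rw [dif_pos h₁, if_neg (by rwa [cons_apply_zero])]
    · rw [dif_neg h₁]
  | cuntz_krieger v =>
    have hstar : ∀ e : E, genAction R G (.edge e) (genAction R G (.star e) f) x =
        if x.edge 0 = e then f x else 0 := by
      intro e
      simp only [genAction_edge, genAction_star]
      split_ifs with h₁ h₂
      · subst h₁
        rw [cons_tail]
      · exact absurd (h₁ ▸ x.source_apply_zero) h₂
      · rfl
    have hmem : x.edge 0 ∈ (hfin v).toFinset ↔ x.vertex 0 = v := Set.Finite.mem_toFinset _
    simp only [pF, sF, tF, map_mul, map_sum, FreeAlgebra.lift_ι_apply, Module.End.mul_apply,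
      LinearMap.sum_apply, Finset.sum_apply, hstar, genAction_vert]
    exact ((Finset.sum_ite_eq _ _ fun _ => f x).trans (if_congr hmem rfl rfl)).symm

/-- The representation of the Leavitt path algebra on functions on infinite paths. -/
def infPathRep : LeavittPathAlgebra R G hfin →ₐ[R] Module.End R (G.InfPath → R) :=
  RingQuot.liftAlgHom R
    ⟨FreeAlgebra.lift R (genAction R G), fun _ _ h => genAction_rel R G hfin h⟩

lemma infPathRep_mk (a : FreeAlgebra R (LGen V E)) :
    infPathRep R G hfin (RingQuot.mkAlgHom R (LRel R G hfin) a) =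
      FreeAlgebra.lift R (genAction R G) a :=
  RingQuot.liftAlgHom_mkAlgHom_apply ..

open Classical in
lemma infPathRep_pL (v : V) (f : G.InfPath → R) (x : G.InfPath) :
    infPathRep R G hfin (pL R G hfin v) f x = if x.vertex 0 = v then f x else 0 := by
  rw [pL, infPathRep_mk, pF, FreeAlgebra.lift_ι_apply, genAction_vert]

/-- The functions supported on the infinite paths that avoid `H`. -/
def avoidingFunctions (H : Set V) : Submodule R (G.InfPath → R) where
  carrier := {f | ∀ x : G.InfPath, (∃ n, x.vertex n ∈ H) → f x = 0}
  add_mem' hf hg x hx := by simp [hf x hx, hg x hx]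
  zero_mem' _ _ := rfl
  smul_mem' c f hf x hx := by simp [hf x hx]

lemma lift_genAction_mem_avoidingFunctions {H : Set V} (hH : ∀ e : E, G.r e ∈ H → G.s e ∈ H)
    (a : FreeAlgebra R (LGen V E)) :
    ∀ f ∈ avoidingFunctions R G H,
      FreeAlgebra.lift R (genAction R G) a f ∈ avoidingFunctions R G H := by
  induction a using FreeAlgebra.induction with
  | grade0 r =>
    intro f hf
    rw [AlgHom.commutes, Module.algebraMap_end_apply]
    exact Submodule.smul_mem _ r hf
  | grade1 g =>
    intro f hf
    rw [FreeAlgebra.lift_ι_apply]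
    rintro x ⟨n, hn⟩
    cases g with
    | vert v => rw [genAction_vert, hf x ⟨n, hn⟩, ite_self]
    | edge e =>
      have : f x.tail = 0 := by
        refine hf _ ⟨n, ?_⟩
        rw [vertex_tail, vertex, ← x.source_edge n]
        exact hH _ hn
      rw [genAction_edge, this, ite_self]
    | star e =>
      rw [genAction_star]
      split_ifs with h
      · exact hf _ ⟨n + 1, hn⟩
      · rfl
  | mul a b ha hb =>
    intro f hf
    rw [map_mul]
    exact ha _ (hb _ hf)
  | add a b ha hb =>
    intro f hf
    rw [map_add]
    exact Submodule.add_mem _ (ha _ hf) (hb _ hf)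

lemma infPathRep_mem_avoidingFunctions (H : HESet G) (a : LeavittPathAlgebra R G hfin)
    {f : G.InfPath → R} (hf : f ∈ avoidingFunctions R G H.1) :
    infPathRep R G hfin a f ∈ avoidingFunctions R G H.1 := by
  obtain ⟨b, rfl⟩ := RingQuot.mkAlgHom_surjective R (LRel R G hfin) a
  rw [infPathRep_mk]
  exact lift_genAction_mem_avoidingFunctions R G H.2.1 b f hf

lemma subset_twoSidedSpan {A : Type*} [NonUnitalNonAssocRing A] (S : Set A) :
    S ⊆ (twoSidedSpan S : Set A) := by
  intro x hx
  rw [SetLike.mem_coe, twoSidedSpan, TwoSidedIdeal.mem_sInf]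
  exact fun J hJ => hJ hx

/-- `I_H` annihilates the functions supported on the infinite paths that avoid `H`. -/
lemma infPathRep_eq_zero_of_mem_IH (H : HESet G) {a : LeavittPathAlgebra R G hfin}
    (ha : a ∈ IH R G hfin H) {f : G.InfPath → R} (hf : f ∈ avoidingFunctions R G H.1) :
    infPathRep R G hfin a f = 0 := by
  let J : TwoSidedIdeal (LeavittPathAlgebra R G hfin) :=
    TwoSidedIdeal.mk' {a | ∀ f ∈ avoidingFunctions R G H.1, infPathRep R G hfin a f = 0}
      (fun f _ => by simp)
      (fun {a b} ha hb f hf => by simp [ha f hf, hb f hf])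
      (fun {a} ha f hf => by simp [ha f hf])
      (fun {a b} hb f hf => by simp [hb f hf])
      (fun {a b} ha f hf => by
        rw [map_mul, Module.End.mul_apply]
        exact ha _ (infPathRep_mem_avoidingFunctions R G hfin H b hf))
  have hJ : a ∈ J := by
    rw [IH, twoSidedSpan, TwoSidedIdeal.mem_sInf] at ha
    apply ha
    rintro _ ⟨v, hv, rfl⟩
    rw [SetLike.mem_coe, TwoSidedIdeal.mem_mk']
    intro f hf
    funext x
    rw [infPathRep_pL]
    split_ifs with h
    · exact hf x ⟨0, h ▸ hv⟩
    · rfl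
  rw [TwoSidedIdeal.mem_mk'] at hJ
  exact hJ f hf

/-- The principal saturated hereditary set generated by a vertex. -/
def principalHE (v : V) : HESet G :=
  ⟨⋂₀ {H | G.SatHereditary H ∧ v ∈ H}, by
    constructor
    · exact fun e he H hH => hH.1.1 e (he H hH)
    · exact fun w hw H hH => hH.1.2 w fun e hre => hw e hre H hH⟩

lemma mem_principalHE (v : V) : v ∈ (principalHE G v).1 := fun _ hH => hH.2

lemma principalHE_subset {v : V} {H : Set V} (hH : G.SatHereditary H) (hv : v ∈ H) :
    (principalHE G v).1 ⊆ H := fun _ hw => hw H ⟨hH, hv⟩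

lemma subset_veeHE {A : Set (HESet G)} {H : HESet G} (hH : H ∈ A) : H.1 ⊆ (veeHE G A).1 :=
  fun _ hv _ hK => hK.2 H.1 ⟨H, hH, rfl⟩ hv

lemma veeHE_subset {A : Set (HESet G)} {K : Set V} (hK : G.SatHereditary K)
    (h : ∀ H ∈ A, H.1 ⊆ K) : (veeHE G A).1 ⊆ K := by
  refine Set.sInter_subset_of_mem ⟨hK, ?_⟩
  rintro _ ⟨H, hH, rfl⟩
  exact h H hH

namespace ConsistentHE

variable {R G} {π : HESet G → Ideal R}

lemma iInf_le (hπ : ConsistentHE R G π) {A : Set (HESet G)} {K : HESet G}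
    (hK : K.1 ⊆ (veeHE G A).1) : ⨅ H ∈ A, π H ≤ π K := by
  have h : veeHE G (insert K A) = veeHE G A := by
    apply Subtype.ext
    apply subset_antisymm
    · refine veeHE_subset G (veeHE G A).2 ?_
      rintro H (rfl | hH)
      · exact hK
      · exact subset_veeHE G hH
    · exact veeHE_subset G (veeHE G _).2 fun H hH => subset_veeHE G (Set.mem_insert_of_mem K hH)
  rw [← hπ A, ← h, hπ]
  exact iInf₂_le K (Set.mem_insert K A)

lemma antitone (hπ : ConsistentHE R G π) {H K : HESet G} (h : K.1 ⊆ H.1) : π H ≤ π K := by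
  have := hπ.iInf_le (A := {H}) (h.trans (subset_veeHE G rfl))
  simpa using this

lemma mem_principalHE_of_forall_source (hπ : ConsistentHE R G π) {c : R} {v : V}
    (h : ∀ e : E, G.r e = v → c ∈ π (principalHE G (G.s e))) : c ∈ π (principalHE G v) := by
  let A : Set (HESet G) := {K | ∃ e, G.r e = v ∧ K = principalHE G (G.s e)}
  apply hπ.iInf_le (A := A)
  · refine principalHE_subset G (veeHE G A).2 ((veeHE G A).2.2 v fun e he => ?_)
    exact subset_veeHE G (A := A) ⟨e, he, rfl⟩ (mem_principalHE G _)
  · simp only [Submodule.mem_iInf]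
    rintro _ ⟨e, he, rfl⟩
    exact h e he

lemma mem_of_forall_principalHE (hπ : ConsistentHE R G π) {c : R} {H : HESet G}
    (h : ∀ v ∈ H.1, c ∈ π (principalHE G v)) : c ∈ π H := by
  let A : Set (HESet G) := principalHE G '' H.1
  apply hπ.iInf_le (A := A)
  · exact fun v hv => subset_veeHE G (A := A) ⟨v, hv, rfl⟩ (mem_principalHE G v)
  · simp only [Submodule.mem_iInf]
    rintro _ ⟨v, hv, rfl⟩
    exact h v hv

/-- The diagonal matrix coefficient of an element of `Γ(π)` at an infinite path `x` lies in
`π` of the principal saturated hereditary set of some vertex on `x`. -/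
lemma exists_infPathRep_mem (hπ : ConsistentHE R G π) {a : LeavittPathAlgebra R G hfin}
    (ha : a ∈ Submodule.span R (GammaLSet R G hfin π)) (x : G.InfPath) [DecidableEq G.InfPath] :
    ∃ n, infPathRep R G hfin a (Pi.single x 1) x ∈ π (principalHE G (x.vertex n)) := by
  have hmono : Monotone fun n => π (principalHE G (x.vertex n)) := by
    refine monotone_nat_of_le_succ fun n => hπ.antitone ?_
    refine principalHE_subset G (principalHE G _).2 ?_
    rw [vertex, vertex, ← x.source_edge n]
    exact (principalHE G _).2.1 _ (mem_principalHE G _)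
  rw [← Submodule.mem_iSup_of_directed _ hmono.directed_le]
  induction ha using Submodule.span_induction with
  | zero => simp
  | add a b _ _ ha hb =>
    rw [map_add]
    exact Submodule.add_mem _ ha hb
  | smul c a _ ha =>
    rw [map_smul]
    exact Submodule.smul_mem _ c ha
  | mem a ha =>
    obtain ⟨c, μ, ν, H, hc, hmem, rfl⟩ := ha
    rw [map_smul, LinearMap.smul_apply, Pi.smul_apply]
    by_cases hx : ∃ n, x.vertex n ∈ H.1
    · obtain ⟨n, hn⟩ := hx
      rw [smul_eq_mul]
      refine Ideal.mul_mem_right _ _ (Submodule.mem_iSup_of_mem n ?_)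
      exact hπ.antitone (principalHE_subset G H.2 hn) hc
    · have hf : (Pi.single x 1 : G.InfPath → R) ∈ avoidingFunctions R G H.1 := by
        intro y hy
        refine Pi.single_eq_of_ne ?_ _
        rintro rfl
        exact hx hy
      rw [infPathRep_eq_zero_of_mem_IH R G hfin H hmem hf]
      simp

end ConsistentHE

lemma smul_pL_mul_self_mem_GammaLSet {π : HESet G → Ideal R} {H : HESet G} {c : R}
    (hc : c ∈ π H) {v : V} (hv : v ∈ H.1) :
    c • (pL R G hfin v * pL R G hfin v) ∈ GammaLSet R G hfin π := by
  let μ : G.Path := ⟨v, [], List.isChain_nil, by simp⟩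
  refine ⟨c, μ, μ, H, hc, ?_, rfl⟩
  exact TwoSidedIdeal.mul_mem_left _ _ _ (subset_twoSidedSpan _ ⟨v, hv, rfl⟩)

/-- for a row-finite graph `E` with no sources satisfying Condition (K) and
functions `π₁, π₂ : H_E → L(R)` with `π(⋁_{H∈A} H) = ⋂_{H∈A} π(H)` for all `A ⊆ H_E`,
one has `Γ(π₁) ⊆ Γ(π₂)` if and only if `π₁(H) ⊆ π₂(H)` for every `H ∈ H_E`. -/
theorem leavitt_Gamma_mono (G : DGraph V E) (hfin : G.RowFinite)
    (hns : G.NoSources) (hK : G.CondK)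
    (π₁ π₂ : HESet G → Ideal R)
    (h₁ : ConsistentHE R G π₁) (h₂ : ConsistentHE R G π₂) :
    ((Submodule.span R (GammaLSet R G hfin π₁) :
        Submodule R (LeavittPathAlgebra R G hfin)) :
      Set (LeavittPathAlgebra R G hfin)) ⊆
      ((Submodule.span R (GammaLSet R G hfin π₂) :
          Submodule R (LeavittPathAlgebra R G hfin)) :
        Set (LeavittPathAlgebra R G hfin)) ↔
      ∀ H : HESet G, π₁ H ≤ π₂ H := by
  constructor
  · intro h H c hc
    refine h₂.mem_of_forall_principalHE fun v hv => ?_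
    by_contra hcv
    obtain ⟨x, hx₀, hx⟩ := G.exists_infPath_avoiding (T := {w | c ∈ π₂ (principalHE G w)})
      (fun w hw => h₂.mem_principalHE_of_forall_source hw) hcv
    classical
    obtain ⟨n, hn⟩ := h₂.exists_infPathRep_mem hfin
      (h (Submodule.subset_span (smul_pL_mul_self_mem_GammaLSet R G hfin hc hv))) x
    refine hx n ?_
    simpa [infPathRep_pL, hx₀] using hn
  · intro h
    refine Submodule.span_mono ?_
    rintro _ ⟨c, μ, ν, H, hc, hmem, rfl⟩
    exact ⟨c, μ, ν, H, h H hc, hmem, rfl⟩
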